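/- Let k be a field and let I ⊆ k[x_0,…,x_n] be a homogeneous ideal whose Hilbert polynomial p has degree d < n, and let L^p_n be the lexicographic ideal for p. Then: (i) for every i ∈ ℕ, dim_k (k[x_0,…,x_n]/I)_i ≥ dim_k (k[x_0,…,x_n]/L^p_n)_i; and (ii) the extension ideal I·k[x_0,…,x_{n+1}] satisfies dim_k (k[x_0,…,x_{n+1}]/(I·k[x_0,…,x_{n+1}]))_i = Σ_{0 ≤ j ≤ i} dim_k (k[x_0,…,x_n]/I)_j for every i ∈ ℕ. -/

import Mathlib

/-- The polynomial binomial coefficient `C(t+a, b) ∈ ℚ[t]`. -/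
noncomputable def polyBinom (a b : ℤ) : Polynomial ℚ :=
  if 0 ≤ b then
    (Nat.factorial b.toNat : ℚ)⁻¹ •
      (descPochhammer ℚ b.toNat).comp (Polynomial.X + Polynomial.C (a : ℚ))
  else 0

/-- The Macaulay–Hartshorne expression `Σ_{i=0}^d [C(t+i, i+1) − C(t+i−e_i, i+1)]`. -/
noncomputable def mhSum (d : ℕ) (e : Fin (d + 1) → ℤ) : Polynomial ℚ :=
  ∑ i : Fin (d + 1),
    (polyBinom ((i : ℕ) : ℤ) (((i : ℕ) : ℤ) + 1) -
      polyBinom (((i : ℕ) : ℤ) - e i) (((i : ℕ) : ℤ) + 1))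

/-- `I` is a homogeneous ideal: it contains all homogeneous components of its elements. -/
def IsHomogeneousIdeal {k : Type*} [Field k] {N : ℕ}
    (I : Ideal (MvPolynomial (Fin N) k)) : Prop :=
  ∀ f ∈ I, ∀ i : ℕ, MvPolynomial.homogeneousComponent i f ∈ I

/-- The Hilbert function of `k[x_0,…,x_{N−1}]/I` in degree `i`: the `k`-dimension of the
degree-`i` homogeneous piece modulo the degree-`i` part of `I`. -/
noncomputable def hilbFn {k : Type*} [Field k] {N : ℕ} (I : Ideal (MvPolynomial (Fin N) k))
    (i : ℕ) : ℕ :=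
  Module.finrank k
    ((MvPolynomial.homogeneousSubmodule (Fin N) k i) ⧸
      (Submodule.comap (MvPolynomial.homogeneousSubmodule (Fin N) k i).subtype
        (Submodule.restrictScalars k I)))

/-- The sequence `e_0, …, e_d` extended by `e_i := 0` for `i > d`. -/
def eExt (d : ℕ) (e : Fin (d + 1) → ℤ) (i : ℕ) : ℤ :=
  if h : i ≤ d then e ⟨i, Nat.lt_succ_of_le h⟩ else 0

/-- `a_j := e_j − e_{j+1}` for the extended sequence. -/
def aSeq (d : ℕ) (e : Fin (d + 1) → ℤ) (j : ℕ) : ℕ :=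
  (eExt d e j - eExt d e (j + 1)).toNat

/-- The exponent vector of the `m`-th generator (for `0 ≤ m ≤ n−1`) of `L(a_0,…,a_{n−1})`:
for `m < n−1` it is `x_0^{a_{n−1}}⋯x_{m−1}^{a_{n−m}}·x_m^{a_{n−1−m}+1}`, and for
`m = n−1` it is `x_0^{a_{n−1}}⋯x_{n−2}^{a_1}·x_{n−1}^{a_0}`. -/
noncomputable def lexExp (n : ℕ) (a : ℕ → ℕ) (m : ℕ) : Fin (n + 1) →₀ ℕ :=
  Finsupp.equivFunOnFinite.symm fun t : Fin (n + 1) =>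
    if (t : ℕ) < m then a (n - 1 - (t : ℕ))
    else if (t : ℕ) = m then (if m = n - 1 then a 0 else a (n - 1 - m) + 1)
    else 0

/-- The monomial ideal `L(a_0,…,a_{n−1}) ⊆ k[x_0,…,x_n]`. -/
noncomputable def lexIdealGen (k : Type*) [Field k] (n : ℕ) (a : ℕ → ℕ) :
    Ideal (MvPolynomial (Fin (n + 1)) k) :=
  Ideal.span ((fun m => MvPolynomial.monomial (lexExp n a m) (1 : k)) '' {m : ℕ | m < n})

section GradedLinearAlgebra

open MvPolynomial Module

variable {k : Type*} [Field k] {N : ℕ}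

/-- The degree-`i` part of an ideal, as a subspace of the polynomial ring. -/
noncomputable def gradedPart (I : Ideal (MvPolynomial (Fin N) k)) (i : ℕ) :
    Submodule k (MvPolynomial (Fin N) k) :=
  homogeneousSubmodule (Fin N) k i ⊓ I.restrictScalars k

theorem mem_gradedPart {I : Ideal (MvPolynomial (Fin N) k)} {i : ℕ} {f : MvPolynomial (Fin N) k} :
    f ∈ gradedPart I i ↔ f.IsHomogeneous i ∧ f ∈ I := by
  simp [gradedPart]

theorem gradedPart_le (I : Ideal (MvPolynomial (Fin N) k)) (i : ℕ) :
    gradedPart I i ≤ homogeneousSubmodule (Fin N) k i := inf_le_left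

instance finite_homogeneousSubmodule (i : ℕ) :
    Module.Finite k (homogeneousSubmodule (Fin N) k i) :=
  Module.Finite.iff_fg.2 (homogeneousSubmodule_fg _ _ i)

instance finite_gradedPart (I : Ideal (MvPolynomial (Fin N) k)) (i : ℕ) :
    Module.Finite k (gradedPart I i) :=
  Submodule.finiteDimensional_of_le (gradedPart_le I i)

theorem hilbFn_add_finrank_gradedPart (I : Ideal (MvPolynomial (Fin N) k)) (i : ℕ) :
    hilbFn I i + finrank k (gradedPart I i) = finrank k (homogeneousSubmodule (Fin N) k i) := by
  have h := Submodule.finrank_quotient_add_finrank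
    (Submodule.comap (homogeneousSubmodule (Fin N) k i).subtype (I.restrictScalars k))
  rw [← h, hilbFn]
  congr 1
  rw [gradedPart, ← Submodule.map_comap_subtype]
  exact ((Submodule.equivMapOfInjective _ (Submodule.injective_subtype _) _).finrank_eq).symm

theorem hilbFn_le_of_gradedPart_le {I J : Ideal (MvPolynomial (Fin N) k)} {i : ℕ}
    (h : gradedPart I i ≤ gradedPart J i) : hilbFn J i ≤ hilbFn I i := by
  have h1 := hilbFn_add_finrank_gradedPart I i
  have h2 := hilbFn_add_finrank_gradedPart J i
  have h3 := Submodule.finrank_mono h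
  omega

theorem hilbFn_congr {I J : Ideal (MvPolynomial (Fin N) k)} {i : ℕ}
    (h : gradedPart I i = gradedPart J i) : hilbFn I i = hilbFn J i :=
  le_antisymm (hilbFn_le_of_gradedPart_le h.ge) (hilbFn_le_of_gradedPart_le h.le)

theorem gradedPart_mono {I J : Ideal (MvPolynomial (Fin N) k)} (h : I ≤ J) (i : ℕ) :
    gradedPart I i ≤ gradedPart J i := fun f hf => by
  rw [mem_gradedPart] at hf ⊢
  exact ⟨hf.1, h hf.2⟩

theorem gradedPart_eq_of_hilbFn_eq {I J : Ideal (MvPolynomial (Fin N) k)} {i : ℕ}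
    (h : gradedPart I i ≤ gradedPart J i) (hh : hilbFn I i = hilbFn J i) :
    gradedPart I i = gradedPart J i := by
  have h1 := hilbFn_add_finrank_gradedPart I i
  have h2 := hilbFn_add_finrank_gradedPart J i
  exact Submodule.eq_of_le_of_finrank_eq h (by omega)

theorem finrank_gradedPart_top (i : ℕ) :
    finrank k (gradedPart (⊤ : Ideal (MvPolynomial (Fin N) k)) i) =
      finrank k (homogeneousSubmodule (Fin N) k i) := by
  rw [show gradedPart (⊤ : Ideal (MvPolynomial (Fin N) k)) i = homogeneousSubmodule (Fin N) k i by
    simp [gradedPart]]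

theorem hilbFn_top (i : ℕ) : hilbFn (⊤ : Ideal (MvPolynomial (Fin N) k)) i = 0 := by
  have h := hilbFn_add_finrank_gradedPart (⊤ : Ideal (MvPolynomial (Fin N) k)) i
  rw [finrank_gradedPart_top] at h
  omega

theorem exists_mem_of_hilbFn_eq_zero {I : Ideal (MvPolynomial (Fin N) k)} {i : ℕ}
    (h : hilbFn I i = 0) {f : MvPolynomial (Fin N) k} (hf : f.IsHomogeneous i) : f ∈ I := by
  have h1 := gradedPart_eq_of_hilbFn_eq (gradedPart_mono le_top i) (h.trans (hilbFn_top i).symm)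
  exact (mem_gradedPart.1 (h1.ge (mem_gradedPart.2 ⟨hf, trivial⟩))).2

theorem finrank_submodule_eq_map_add_inf_ker {V W : Type*} [AddCommGroup V] [Module k V]
    [AddCommGroup W] [Module k W] (φ : V →ₗ[k] W) (p : Submodule k V) [Module.Finite k p] :
    finrank k p = finrank k (p.map φ) + finrank k (p ⊓ LinearMap.ker φ : Submodule k V) := by
  rw [← (φ.domRestrict p).finrank_range_add_finrank_ker, LinearMap.range_domRestrict,
    LinearMap.ker_domRestrict, ← Submodule.map_comap_subtype,
    (Submodule.equivMapOfInjective _ p.injective_subtype _).finrank_eq]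

theorem homogeneousComponent_map_of_isHomogeneous {σ τ K L : Type*} [Field K] [Field L]
    {F : Type*} [FunLike F (MvPolynomial σ K) (MvPolynomial τ L)]
    [AddMonoidHomClass F (MvPolynomial σ K) (MvPolynomial τ L)] (φ : F)
    (hφ : ∀ i f, f.IsHomogeneous i → (φ f).IsHomogeneous i) (i : ℕ) (f : MvPolynomial σ K) :
    homogeneousComponent i (φ f) = φ (homogeneousComponent i f) := by
  classical
  conv_lhs => rw [← sum_homogeneousComponent f, map_sum, map_sum]
  rw [Finset.sum_congr rfl fun j _ => homogeneousComponent_of_mem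
    (hφ j _ (homogeneousComponent_isHomogeneous j f))]
  rw [Finset.sum_ite_eq]
  split_ifs with h
  · rfl
  · rw [homogeneousComponent_eq_zero, map_zero]
    simpa using h

theorem homogeneousComponent_add_mul {σ : Type*} {g : MvPolynomial σ k} {d : ℕ}
    (hg : g.IsHomogeneous d) (i : ℕ) (f : MvPolynomial σ k) :
    homogeneousComponent (i + d) (g * f) = g * homogeneousComponent i f := by
  classical
  conv_lhs => rw [← sum_homogeneousComponent f, Finset.mul_sum, map_sum]
  rw [Finset.sum_congr rfl fun j _ => homogeneousComponent_of_mem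
    (hg.mul (homogeneousComponent_isHomogeneous j f))]
  simp only [add_comm i d, add_right_inj, Finset.sum_ite_eq]
  split_ifs with h
  · rfl
  · rw [homogeneousComponent_eq_zero, mul_zero]
    simpa using h

theorem isHomogeneousIdeal_span {s : Set (MvPolynomial (Fin N) k)}
    (h : ∀ f ∈ s, ∃ i, f.IsHomogeneous i) : IsHomogeneousIdeal (Ideal.span s) := by
  let := MvPolynomial.gradedAlgebra (σ := Fin N) (R := k)
  intro f hf i
  exact homogeneousComponent_mem_of_mem (Ideal.homogeneous_span _ s h) hf i

theorem IsHomogeneousIdeal.span_homogeneous {I : Ideal (MvPolynomial (Fin N) k)}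
    (hI : IsHomogeneousIdeal I) : Ideal.span {f | f ∈ I ∧ ∃ i, f.IsHomogeneous i} = I := by
  refine le_antisymm (Ideal.span_le.2 fun f hf => hf.1) fun f hf => ?_
  rw [← sum_homogeneousComponent f]
  exact Ideal.sum_mem _ fun i _ =>
    Ideal.subset_span ⟨hI f hf i, i, homogeneousComponent_isHomogeneous i f⟩

theorem IsHomogeneousIdeal.map {K L : Type*} [Field K] [Field L] {M : ℕ}
    {I : Ideal (MvPolynomial (Fin N) K)} (hI : IsHomogeneousIdeal I)
    (φ : MvPolynomial (Fin N) K →+* MvPolynomial (Fin M) L)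
    (hφ : ∀ i f, f.IsHomogeneous i → (φ f).IsHomogeneous i) : IsHomogeneousIdeal (I.map φ) := by
  rw [← hI.span_homogeneous, Ideal.map_span]
  refine isHomogeneousIdeal_span ?_
  rintro _ ⟨f, ⟨_, i, hf⟩, rfl⟩
  exact ⟨i, hφ i f hf⟩

theorem IsHomogeneousIdeal.sup {I J : Ideal (MvPolynomial (Fin N) k)}
    (hI : IsHomogeneousIdeal I) (hJ : IsHomogeneousIdeal J) : IsHomogeneousIdeal (I ⊔ J) := by
  rw [← hI.span_homogeneous, ← hJ.span_homogeneous, ← Ideal.span_union]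
  refine isHomogeneousIdeal_span ?_
  rintro f (hf | hf)
  exacts [hf.2, hf.2]

end GradedLinearAlgebra

section LexHilbertFunction

open Finset

/-- The Hilbert function of the lexicographic ideal in `n + 1` variables attached to the
sequence `e`. -/
def lexHilb (n : ℕ) (e : ℕ → ℕ) (i : ℕ) : ℕ :=
  ∑ j ∈ range n, ∑ c ∈ Ico (e (j + 1)) (e j), if c ≤ i then (i - c + j).choose j else 0

theorem sum_range_ite_choose (c j i : ℕ) :
    ∑ t ∈ range (i + 1), (if c ≤ t then (t - c + j).choose j else 0) =
      if c ≤ i then (i - c + (j + 1)).choose (j + 1) else 0 := by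
  induction i with
  | zero => by_cases h : c = 0 <;> simp [h]
  | succ i ih =>
    rw [sum_range_succ, ih]
    rcases lt_trichotomy c (i + 1) with h | h | h
    · have h1 : i + 1 - c = (i - c) + 1 := by omega
      rw [if_pos (by omega), if_pos (by omega), if_pos (by omega), h1,
        show i - c + 1 + (j + 1) = (i - c + 1 + j) + 1 by ring, Nat.choose_succ_succ,
        show i - c + 1 + j = i - c + (j + 1) by ring, add_comm]
    · rw [if_neg (by omega), if_pos (by omega), if_pos (by omega)]
      simp [h]
    · rw [if_neg (by omega), if_neg (by omega), if_neg (by omega)]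

theorem lexHilb_succ (n : ℕ) (e : ℕ → ℕ) (i : ℕ) :
    lexHilb (n + 1) e i = ∑ t ∈ range (i + 1), lexHilb n (fun j => e (j + 1)) t +
      min (i + 1 - e 1) (e 0 - e 1) := by
  rw [lexHilb, sum_range_succ']
  congr 1
  · simp only [lexHilb]
    rw [sum_comm]
    refine sum_congr rfl fun j _ => ?_
    rw [sum_comm]
    exact sum_congr rfl fun c _ => (sum_range_ite_choose c j i).symm
  · have h : (Ico (e 1) (e 0)).filter (fun c => c ≤ i) = Ico (e 1) (min (i + 1) (e 0)) := by
      ext c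
      simp only [mem_filter, mem_Ico]
      omega
    simp only [zero_add, Nat.choose_zero_right, ← sum_filter, sum_const, smul_eq_mul, mul_one, h,
      Nat.card_Ico]
    omega

theorem sum_Ico_choose {a b i : ℕ} (hab : a ≤ b) (hb : b ≤ i) (j : ℕ) :
    ∑ c ∈ Ico a b, (if c ≤ i then (i - c + j).choose j else 0) +
      (i - b + (j + 1)).choose (j + 1) = (i - a + (j + 1)).choose (j + 1) := by
  induction b, hab using Nat.le_induction with
  | base => simp
  | succ b hab ih =>
    rw [sum_Ico_succ_top hab, ← ih (by omega), if_pos (by omega), add_assoc]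
    congr 1
    have h1 : i - b = (i - (b + 1)) + 1 := by omega
    rw [h1, show i - (b + 1) + 1 + (j + 1) = (i - (b + 1) + 1 + j) + 1 by ring,
      Nat.choose_succ_succ, show i - (b + 1) + 1 + j = i - (b + 1) + (j + 1) by ring]

theorem lexHilb_add_sum_choose (n : ℕ) {e : ℕ → ℕ} (he : Antitone e) {i : ℕ} (hi : e 0 ≤ i) :
    lexHilb n e i + (∑ j ∈ range n, (i - e j + j).choose (j + 1)) + 1 =
      (i - e n + n).choose n := by
  induction n with
  | zero => simp [lexHilb]
  | succ n ih =>
    have h1 := sum_Ico_choose (he n.le_succ) ((he n.zero_le).trans hi) n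
    have h2 : (i - e n + (n + 1)).choose (n + 1) =
        (i - e n + n).choose n + (i - e n + n).choose (n + 1) := Nat.choose_succ_succ _ _
    rw [sum_range_succ]
    rw [show lexHilb (n + 1) e i = lexHilb n e i + _ from sum_range_succ _ _]
    simp only [Nat.succ_eq_add_one] at *
    omega

theorem sum_choose_add_one (n i : ℕ) :
    (∑ j ∈ range n, (i + j).choose (j + 1)) + 1 = (i + n).choose n := by
  induction n with
  | zero => simp
  | succ n ih =>
    rw [sum_range_succ, ← add_assoc i n 1, Nat.choose_succ_succ, ← ih]
    ring

theorem polyBinom_eval (a : ℤ) (b i m : ℕ) (h : (i : ℤ) + a = m) :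
    (polyBinom a b).eval (i : ℚ) = m.choose b := by
  have h' : (i : ℚ) + a = m := by exact_mod_cast h
  rw [polyBinom, if_pos (by positivity)]
  simp only [Int.toNat_natCast, Polynomial.eval_smul, Polynomial.eval_comp, Polynomial.eval_add,
    Polynomial.eval_X, Polynomial.eval_C, smul_eq_mul, h']
  rw [descPochhammer_eval_eq_descFactorial, Nat.descFactorial_eq_factorial_mul_choose]
  push_cast
  rw [inv_mul_cancel_left₀ (by positivity)]

theorem antitone_eExt {d : ℕ} {e : Fin (d + 1) → ℤ} (he : Antitone e) :
    Antitone fun j => (eExt d e j).toNat := by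
  intro a b hab
  simp only [eExt]
  split_ifs with h1 h2
  · exact Int.toNat_le_toNat (he hab)
  · omega
  · simp
  · simp

theorem eval_mhSum {n d : ℕ} (hdn : d < n) {e : Fin (d + 1) → ℤ} (he : Antitone e)
    (hepos : ∀ i, 0 < e i) {i : ℕ} (hi : (eExt d e 0).toNat ≤ i) :
    (mhSum d e).eval (i : ℚ) = lexHilb n (fun j => (eExt d e j).toNat) i := by
  set e' : ℕ → ℕ := fun j => (eExt d e j).toNat with he'
  have hanti : Antitone e' := antitone_eExt he
  have hz : ∀ j, d < j → e' j = 0 := fun j hj => by simp [he', eExt, not_le.2 hj]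
  have h1 : (mhSum d e).eval (i : ℚ) =
      ∑ j ∈ range n, (((i + j).choose (j + 1) : ℚ) - (i - e' j + j).choose (j + 1)) := by
    rw [← sum_subset (range_mono (Nat.succ_le_of_lt hdn)) fun j _ hj => by
      rw [hz j (by simpa using hj)]; simp]
    rw [mhSum, Polynomial.eval_finsetSum, ← Fin.sum_univ_eq_sum_range
      (fun j => ((i + j).choose (j + 1) : ℚ) - (i - e' j + j).choose (j + 1))]
    refine sum_congr rfl fun j _ => ?_
    have hj : (e' j : ℤ) = e j := by
      simp [he', eExt, Nat.le_of_lt_succ j.2, (hepos j).le]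
    have hle : e' j ≤ i := (hanti j.1.zero_le).trans hi
    rw [Polynomial.eval_sub]
    have := polyBinom_eval (j : ℕ) (j + 1) i (i + j) (by push_cast; ring)
    have := polyBinom_eval ((j : ℕ) - e j) (j + 1) i (i - e' j + j) (by rw [← hj]; omega)
    push_cast at *
    simp_all
  have h2 := lexHilb_add_sum_choose n hanti hi
  rw [hz n hdn, Nat.sub_zero, ← sum_choose_add_one] at h2
  have h3 := congrArg (Nat.cast : ℕ → ℚ) h2
  push_cast at h3
  rw [h1, sum_sub_distrib]
  linarith

end LexHilbertFunction

section HyperplaneRestriction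

open MvPolynomial Module

/-- The restriction of polynomials to the hyperplane `form = 0`, which is identified with the
coordinate hyperplane that omits `pivot`. -/
structure HyperplaneRestriction (k : Type*) [Field k] (N : ℕ) where
  toHom : MvPolynomial (Fin (N + 1)) k →ₐ[k] MvPolynomial (Fin N) k
  form : MvPolynomial (Fin (N + 1)) k
  pivot : Fin (N + 1)
  isHomogeneous_form : form.IsHomogeneous 1
  form_ne_zero : form ≠ 0
  isHomogeneous_toHom_X : ∀ s, (toHom (X s)).IsHomogeneous 1
  toHom_X_succAbove : ∀ s, toHom (X (pivot.succAbove s)) = X s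
  toHom_eq_zero_iff : ∀ f, toHom f = 0 ↔ form ∣ f

theorem HyperplaneRestriction.exists_of_form {k : Type*} [Field k] {N : ℕ}
    {ℓ : MvPolynomial (Fin (N + 1)) k} (hℓ : ℓ.IsHomogeneous 1) (hℓ0 : ℓ ≠ 0) :
    ∃ r : HyperplaneRestriction k N, r.form = ℓ := by
  obtain ⟨c, rfl⟩ : ∃ c : Fin (N + 1) → k, ℓ = ∑ i, C (c i) * X i := by
    have h : ℓ ∈ homogeneousSubmodule (Fin (N + 1)) k 1 := hℓ
    rw [homogeneousSubmodule_one_eq_span_X, Submodule.mem_span_range_iff_exists_fun] at h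
    obtain ⟨c, rfl⟩ := h
    exact ⟨c, by simp [smul_eq_C_mul]⟩
  obtain ⟨m, hm⟩ : ∃ m, c m ≠ 0 := by
    by_contra! h
    simp [h] at hℓ0
  set g : Fin (N + 1) → MvPolynomial (Fin N) k :=
    m.insertNth (C (-(c m)⁻¹) * ∑ j, C (c (m.succAbove j)) * X j) X with hg
  have hgm : g m = C (-(c m)⁻¹) * ∑ j, C (c (m.succAbove j)) * X j := by simp [hg]
  have hgs : ∀ j, g (m.succAbove j) = X j := by simp [hg]
  have hzero : aeval g (∑ i, C (c i) * X i) = 0 := by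
    rw [Fin.sum_univ_succAbove _ m]
    simp only [map_add, map_mul, map_sum, aeval_X, algHom_C, hgm, hgs, algebraMap_eq]
    rw [← mul_assoc, ← C_mul, mul_neg, mul_inv_cancel₀ hm]
    simp
  refine ⟨⟨aeval g, _, m, hℓ, hℓ0, fun s => ?_, fun s => ?_, fun f => ⟨fun hf => ?_, ?_⟩⟩, rfl⟩
  · rw [aeval_X]
    induction s using m.succAboveCases with
    | x =>
      rw [hgm]
      exact (IsHomogeneous.sum _ _ _ fun j _ => (isHomogeneous_X _ j).C_mul _).C_mul _
    | p s =>
      rw [hgs]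
      exact isHomogeneous_X _ s
  · rw [aeval_X, hgs]
  · rw [← Ideal.mem_span_singleton, ← Ideal.Quotient.eq_zero_iff_mem,
      ← Ideal.Quotient.mkₐ_eq_mk k]
    have h : ((Ideal.Quotient.mkₐ k (Ideal.span {∑ i, C (c i) * X i})).comp
        (rename m.succAbove)).comp (aeval g) =
        Ideal.Quotient.mkₐ k (Ideal.span {∑ i, C (c i) * X i}) := by
      ext s
      induction s using m.succAboveCases with
      | x =>
        simp only [AlgHom.comp_apply, aeval_X, hgm, map_mul, map_sum, rename_X, rename_C]
        rw [eq_comm, ← sub_eq_zero]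
        simp only [← map_mul, ← map_sum, ← map_sub]
        rw [Ideal.Quotient.mkₐ_eq_mk, Ideal.Quotient.eq_zero_iff_mem, Ideal.mem_span_singleton]
        refine ⟨C (c m)⁻¹, ?_⟩
        rw [Fin.sum_univ_succAbove _ m, add_mul, mul_right_comm, ← C_mul, mul_inv_cancel₀ hm]
        simp only [map_neg, map_one]
        ring
      | p s => simp [hgs]
    rw [← h, AlgHom.comp_apply, AlgHom.comp_apply, hf, map_zero, map_zero]
  · rintro ⟨f, rfl⟩
    rw [map_mul, hzero, zero_mul]

namespace HyperplaneRestriction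

variable {k : Type*} [Field k] {N : ℕ} (r : HyperplaneRestriction k N)

theorem isHomogeneous_toHom {i : ℕ} {f : MvPolynomial (Fin (N + 1)) k} (hf : f.IsHomogeneous i) :
    (r.toHom f).IsHomogeneous i := by
  rw [aeval_unique r.toHom]
  simpa using hf.aeval (r.toHom ∘ X) r.isHomogeneous_toHom_X

theorem toHom_rename (f : MvPolynomial (Fin N) k) :
    r.toHom (rename r.pivot.succAbove f) = f := by
  have h : r.toHom.comp (rename r.pivot.succAbove) = AlgHom.id k _ := by
    ext s
    simp [r.toHom_X_succAbove]
  exact DFunLike.congr_fun h f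

theorem homogeneousComponent_toHom (i : ℕ) (f : MvPolynomial (Fin (N + 1)) k) :
    homogeneousComponent i (r.toHom f) = r.toHom (homogeneousComponent i f) :=
  homogeneousComponent_map_of_isHomogeneous r.toHom (fun _ _ => r.isHomogeneous_toHom) i f

/-- The ideal cut out by `I` on the hyperplane. -/
noncomputable def restrict (I : Ideal (MvPolynomial (Fin (N + 1)) k)) :
    Ideal (MvPolynomial (Fin N) k) :=
  I.map r.toHom.toRingHom

theorem isHomogeneousIdeal_restrict {I : Ideal (MvPolynomial (Fin (N + 1)) k)}
    (hI : IsHomogeneousIdeal I) : IsHomogeneousIdeal (r.restrict I) :=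
  hI.map _ fun _ _ => r.isHomogeneous_toHom

theorem exists_of_mem_restrict {I : Ideal (MvPolynomial (Fin (N + 1)) k)}
    (hI : IsHomogeneousIdeal I) {i : ℕ} {f : MvPolynomial (Fin N) k} (hf : f ∈ r.restrict I)
    (hfi : f.IsHomogeneous i) : ∃ g ∈ I, g.IsHomogeneous i ∧ r.toHom g = f := by
  obtain ⟨g, hg, rfl⟩ := (Ideal.mem_map_iff_of_surjective r.toHom.toRingHom
    fun f => ⟨_, r.toHom_rename f⟩).1 hf
  refine ⟨homogeneousComponent i g, hI g hg i, homogeneousComponent_isHomogeneous i g, ?_⟩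
  rw [← homogeneousComponent_toHom]
  exact homogeneousComponent_eq_self hfi

theorem map_gradedPart {I : Ideal (MvPolynomial (Fin (N + 1)) k)} (hI : IsHomogeneousIdeal I)
    (i : ℕ) : (gradedPart I i).map r.toHom.toLinearMap = gradedPart (r.restrict I) i := by
  ext f
  rw [mem_gradedPart, Submodule.mem_map]
  constructor
  · rintro ⟨g, hg, rfl⟩
    rw [mem_gradedPart] at hg
    exact ⟨r.isHomogeneous_toHom hg.1, Ideal.mem_map_of_mem _ hg.2⟩
  · rintro ⟨hfi, hf⟩
    obtain ⟨g, hg, hgi, rfl⟩ := r.exists_of_mem_restrict hI hf hfi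
    exact ⟨g, mem_gradedPart.2 ⟨hgi, hg⟩, rfl⟩

theorem exists_mul_form {I : Ideal (MvPolynomial (Fin (N + 1)) k)} (hI : IsHomogeneousIdeal I)
    (hreg : ∀ f, r.form * f ∈ I → f ∈ I) {i : ℕ} {f : MvPolynomial (Fin (N + 1)) k} (hf : f ∈ I)
    (hfi : f.IsHomogeneous (i + 1)) (h : r.toHom f = 0) :
    ∃ g ∈ I, g.IsHomogeneous i ∧ f = r.form * g := by
  obtain ⟨g, rfl⟩ := (r.toHom_eq_zero_iff f).1 h
  refine ⟨homogeneousComponent i g, hI g (hreg g hf) i,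
    homogeneousComponent_isHomogeneous i g, ?_⟩
  rw [← homogeneousComponent_add_mul r.isHomogeneous_form]
  exact (homogeneousComponent_eq_self hfi).symm

theorem gradedPart_succ_inf_ker {I : Ideal (MvPolynomial (Fin (N + 1)) k)}
    (hI : IsHomogeneousIdeal I) (hreg : ∀ f, r.form * f ∈ I → f ∈ I) (i : ℕ) :
    gradedPart I (i + 1) ⊓ LinearMap.ker r.toHom.toLinearMap =
      (gradedPart I i).map (LinearMap.mulLeft k r.form) := by
  ext f
  simp only [Submodule.mem_inf, mem_gradedPart, LinearMap.mem_ker, Submodule.mem_map,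
    LinearMap.mulLeft_apply, AlgHom.toLinearMap_apply]
  constructor
  · rintro ⟨⟨hfi, hf⟩, h⟩
    obtain ⟨g, hg, hgi, rfl⟩ := r.exists_mul_form hI hreg hf hfi h
    exact ⟨g, ⟨hgi, hg⟩, rfl⟩
  · rintro ⟨g, ⟨hgi, hg⟩, rfl⟩
    refine ⟨⟨?_, I.mul_mem_left _ hg⟩, (r.toHom_eq_zero_iff _).2 (dvd_mul_right _ _)⟩
    exact add_comm 1 i ▸ r.isHomogeneous_form.mul hgi

theorem gradedPart_zero_inf_ker (I : Ideal (MvPolynomial (Fin (N + 1)) k)) :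
    gradedPart I 0 ⊓ LinearMap.ker r.toHom.toLinearMap = ⊥ := by
  refine eq_bot_iff.2 fun f hf => ?_
  simp only [Submodule.mem_inf, mem_gradedPart, LinearMap.mem_ker, AlgHom.toLinearMap_apply] at hf
  obtain ⟨⟨hf0, -⟩, hf⟩ := hf
  rw [← totalDegree_zero_iff_isHomogeneous, totalDegree_eq_zero_iff_eq_C] at hf0
  rw [hf0] at hf ⊢
  simpa using hf

theorem finrank_gradedPart_succ {I : Ideal (MvPolynomial (Fin (N + 1)) k)}
    (hI : IsHomogeneousIdeal I) (hreg : ∀ f, r.form * f ∈ I → f ∈ I) (i : ℕ) :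
    finrank k (gradedPart I (i + 1)) =
      finrank k (gradedPart (r.restrict I) (i + 1)) + finrank k (gradedPart I i) := by
  rw [finrank_submodule_eq_map_add_inf_ker r.toHom.toLinearMap, r.map_gradedPart hI,
    r.gradedPart_succ_inf_ker hI hreg]
  congr 1
  exact ((Submodule.equivMapOfInjective _
    (fun _ _ h => mul_left_cancel₀ r.form_ne_zero h) _).finrank_eq).symm

theorem finrank_gradedPart_zero {I : Ideal (MvPolynomial (Fin (N + 1)) k)}
    (hI : IsHomogeneousIdeal I) :
    finrank k (gradedPart I 0) = finrank k (gradedPart (r.restrict I) 0) := by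
  rw [finrank_submodule_eq_map_add_inf_ker r.toHom.toLinearMap, r.map_gradedPart hI,
    r.gradedPart_zero_inf_ker, finrank_bot, add_zero]

theorem restrict_top : r.restrict ⊤ = ⊤ := Ideal.map_top _

theorem hilbFn_eq_sum {I : Ideal (MvPolynomial (Fin (N + 1)) k)} (hI : IsHomogeneousIdeal I)
    (hreg : ∀ f, r.form * f ∈ I → f ∈ I) (i : ℕ) :
    hilbFn I i = ∑ j ∈ Finset.range (i + 1), hilbFn (r.restrict I) j := by
  have htop : IsHomogeneousIdeal (⊤ : Ideal (MvPolynomial (Fin (N + 1)) k)) :=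
    fun _ _ _ => trivial
  have hI' := fun i => hilbFn_add_finrank_gradedPart (r.restrict I) i
  have hIi := fun i => hilbFn_add_finrank_gradedPart I i
  induction i with
  | zero =>
    have h1 := r.finrank_gradedPart_zero hI
    have h2 := r.finrank_gradedPart_zero htop
    rw [restrict_top, finrank_gradedPart_top, finrank_gradedPart_top] at h2
    have h3 := hI' 0
    have h4 := hIi 0
    simp only [zero_add, Finset.sum_range_one]
    omega
  | succ i ih =>
    rw [Finset.sum_range_succ, ← ih]
    have h1 := r.finrank_gradedPart_succ hI hreg i
    have h2 := r.finrank_gradedPart_succ htop (fun _ _ => trivial) i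
    rw [restrict_top, finrank_gradedPart_top, finrank_gradedPart_top, finrank_gradedPart_top] at h2
    have h3 := hI' (i + 1)
    have h4 := hIi (i + 1)
    have h5 := hIi i
    omega

end HyperplaneRestriction

end HyperplaneRestriction

section Extension

open MvPolynomial

theorem X_last_mul_mem_map_rename {k : Type*} [Field k] {N : ℕ}
    (I : Ideal (MvPolynomial (Fin N) k)) (f : MvPolynomial (Fin (N + 1)) k)
    (hf : X (Fin.last N) * f ∈ I.map (rename (Fin.castSucc : Fin N → Fin (N + 1)))) :
    f ∈ I.map (rename (Fin.castSucc : Fin N → Fin (N + 1))) := by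
  let ψ : MvPolynomial (Fin (N + 1)) k ≃ₐ[k] Polynomial (MvPolynomial (Fin N) k) :=
    (renameEquiv k (finSuccEquivLast (n := N))).trans (optionEquivLeft k (Fin N))
  have hC : ∀ g, ψ (rename Fin.castSucc g) = Polynomial.C g := by
    intro g
    have h : ψ.toAlgHom.comp (rename (Fin.castSucc : Fin N → Fin (N + 1))) = Polynomial.CAlgHom := by
      ext s : 1
      simp [ψ]
    exact DFunLike.congr_fun h g
  have hmem : ∀ g, g ∈ I.map (rename (Fin.castSucc : Fin N → Fin (N + 1))) ↔
      ψ g ∈ I.map Polynomial.C := by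
    refine fun g => ⟨fun hg => ?_, fun hg => ?_⟩
    · have h : I.map (rename (Fin.castSucc : Fin N → Fin (N + 1))) ≤
          (I.map Polynomial.C).comap ψ := by
        refine Ideal.map_le_iff_le_comap.2 fun g hg => ?_
        rw [Ideal.mem_comap, Ideal.mem_comap, hC]
        exact Ideal.mem_map_of_mem _ hg
      exact h hg
    · have h : I.map Polynomial.C ≤
          (I.map (rename (Fin.castSucc : Fin N → Fin (N + 1)))).comap ψ.symm := by
        refine Ideal.map_le_iff_le_comap.2 fun g hg => ?_
        rw [Ideal.mem_comap, Ideal.mem_comap, ← hC, ψ.symm_apply_apply]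
        exact Ideal.mem_map_of_mem _ hg
      simpa using h hg
  rw [hmem, Ideal.mem_map_C_iff] at hf ⊢
  intro j
  have := hf (j + 1)
  have hX : ψ (X (Fin.last N)) = Polynomial.X := by
    simp [ψ]
  rwa [map_mul, hX, Polynomial.coeff_X_mul] at this

theorem hilbFn_map_rename_castSucc {k : Type*} [Field k] {N : ℕ}
    {I : Ideal (MvPolynomial (Fin N) k)} (hI : IsHomogeneousIdeal I) (i : ℕ) :
    hilbFn (I.map (rename (Fin.castSucc : Fin N → Fin (N + 1)))) i =
      ∑ j ∈ Finset.range (i + 1), hilbFn I j := by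
  obtain ⟨r, hr⟩ := HyperplaneRestriction.exists_of_form
    (isHomogeneous_X k (Fin.last N)) (X_ne_zero _)
  have hI' : IsHomogeneousIdeal (I.map (rename (Fin.castSucc : Fin N → Fin (N + 1)))) :=
    hI.map (rename (Fin.castSucc : Fin N → Fin (N + 1))).toRingHom
      fun _ _ h => h.rename_isHomogeneous
  have hpiv : r.pivot = Fin.last N := by
    by_contra h
    obtain ⟨s, hs⟩ := Fin.exists_succAbove_eq (Ne.symm h)
    have h1 := (r.toHom_eq_zero_iff _).2 (dvd_refl _)
    rw [hr, ← hs, r.toHom_X_succAbove] at h1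
    exact X_ne_zero s h1
  rw [r.hilbFn_eq_sum hI' (by rw [hr]; exact X_last_mul_mem_map_rename I)]
  refine Finset.sum_congr rfl fun j _ => ?_
  congr 1
  have h : r.toHom.toRingHom.comp
      (rename (R := k) (Fin.castSucc : Fin N → Fin (N + 1))).toRingHom = RingHom.id _ := by
    refine RingHom.ext fun f => ?_
    have := r.toHom_rename f
    rwa [hpiv, Fin.succAbove_last] at this
  exact (Ideal.map_map _ _).trans (by rw [h, Ideal.map_id])

end Extension

section Saturation

open MvPolynomial Module

variable {k : Type*} [Field k] {N : ℕ}

/-- An ideal is saturated with respect to the irrelevant ideal if it contains every `f` all of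
whose multiples by variables it contains. -/
def IsIrrelevantSaturated (I : Ideal (MvPolynomial (Fin N) k)) : Prop :=
  ∀ f, (∀ s, X s * f ∈ I) → f ∈ I

theorem MvPolynomial.IsHomogeneous.mem_span_range_X {f : MvPolynomial (Fin N) k} {i : ℕ}
    (hf : f.IsHomogeneous (i + 1)) : f ∈ Ideal.span (Set.range X) := by
  rw [← Set.image_univ, mem_ideal_span_X_image]
  intro d hd
  by_contra! h
  have hd0 : d = 0 := Finsupp.ext fun s => h s trivial
  have := hf.degree_eq_sum_deg_support hd
  simp [hd0] at this

theorem exists_isIrrelevantSaturated_ge {I : Ideal (MvPolynomial (Fin N) k)}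
    (hI : IsHomogeneousIdeal I) :
    ∃ J, I ≤ J ∧ IsHomogeneousIdeal J ∧ IsIrrelevantSaturated J ∧
      ∃ M, ∀ i, M ≤ i → gradedPart J i = gradedPart I i := by
  let S : Set (Ideal (MvPolynomial (Fin N) k)) :=
    {J | I ≤ J ∧ IsHomogeneousIdeal J ∧ ∃ M, ∀ i, M ≤ i → gradedPart J i = gradedPart I i}
  obtain ⟨J, ⟨hIJ, hJ, M, hM⟩, hmax⟩ :=
    WellFounded.has_min (wellFounded_gt : WellFounded
      ((· > ·) : Ideal (MvPolynomial (Fin N) k) → _ → Prop)) S ⟨I, le_rfl, hI, 0, fun _ _ => rfl⟩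
  refine ⟨J, hIJ, hJ, fun f hf => ?_, M, hM⟩
  rw [← sum_homogeneousComponent f]
  refine Ideal.sum_mem _ fun d _ => ?_
  set g := homogeneousComponent d f with hgdef
  have hgd : g.IsHomogeneous d := homogeneousComponent_isHomogeneous d f
  have hg : ∀ s, X s * g ∈ J := fun s => by
    have := hJ _ (hf s) (d + 1)
    rwa [homogeneousComponent_add_mul (isHomogeneous_X k s)] at this
  have hspan : IsHomogeneousIdeal (Ideal.span {g}) :=
    isHomogeneousIdeal_span fun f hf => ⟨d, by rwa [Set.mem_singleton_iff.1 hf]⟩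
  have hmem : J ⊔ Ideal.span {g} ∈ S := by
    refine ⟨hIJ.trans le_sup_left, hJ.sup hspan, max M (d + 1), fun i hi => ?_⟩
    rw [← hM i (le_of_max_le_left hi)]
    refine le_antisymm (fun q hq => ?_) (gradedPart_mono le_sup_left i)
    rw [mem_gradedPart] at hq ⊢
    refine ⟨hq.1, ?_⟩
    obtain ⟨a, ha, b, hb, rfl⟩ := Submodule.mem_sup.1 hq.2
    obtain ⟨c, rfl⟩ := Ideal.mem_span_singleton'.1 hb
    rw [← homogeneousComponent_eq_self hq.1, map_add]
    refine J.add_mem (hJ a ha i) ?_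
    obtain ⟨m, rfl⟩ := Nat.exists_eq_add_of_le' (le_of_max_le_right hi)
    rw [mul_comm, ← add_assoc, add_right_comm, homogeneousComponent_add_mul hgd]
    have hc : homogeneousComponent (m + 1) c ∈ Ideal.span (Set.range X) :=
      (homogeneousComponent_isHomogeneous (m + 1) c).mem_span_range_X
    have hle : Ideal.span (Set.range X) ≤ J.colon {g} := by
      refine Ideal.span_le.2 ?_
      rintro _ ⟨s, rfl⟩
      simpa [Submodule.mem_colon_singleton] using hg s
    simpa [Submodule.mem_colon_singleton, mul_comm] using hle hc
  have := hmax _ hmem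
  by_contra hgJ
  exact this (lt_of_le_of_ne le_sup_left fun h =>
    hgJ (h.ge (Ideal.mem_sup_right (Ideal.mem_span_singleton_self g))))

theorem IsIrrelevantSaturated.exists_regular_form [Infinite k]
    {I : Ideal (MvPolynomial (Fin (N + 1)) k)} (hI : IsIrrelevantSaturated I) :
    ∃ ℓ : MvPolynomial (Fin (N + 1)) k, ℓ.IsHomogeneous 1 ∧ ℓ ≠ 0 ∧ ∀ f, ℓ * f ∈ I → f ∈ I := by
  classical
  set A := MvPolynomial (Fin (N + 1)) k with hA
  set V := homogeneousSubmodule (Fin (N + 1)) k 1 with hV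
  let F : Ideal A → Submodule k V := fun P => (P.restrictScalars k).comap V.subtype
  have hfin := associatedPrimes.finite A (A ⧸ I)
  let s : Finset (Submodule k V) := insert ⊥ (hfin.toFinset.image F)
  have hs : ⊤ ∉ s := by
    intro h
    rcases Finset.mem_insert.1 h with h | h
    · have hX : (⟨X 0, isHomogeneous_X k 0⟩ : V) ∈ (⊥ : Submodule k V) := h ▸ trivial
      exact X_ne_zero (R := k) (0 : Fin (N + 1)) (congrArg Subtype.val ((Submodule.mem_bot k).1 hX))
    · obtain ⟨P, hP, hPtop⟩ := Finset.mem_image.1 h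
      rw [Set.Finite.mem_toFinset, AssociatedPrimes.mem_iff, isAssociatedPrime_iff] at hP
      obtain ⟨hprime, x, rfl⟩ := hP
      obtain ⟨f, rfl⟩ := Ideal.Quotient.mk_surjective x
      refine hprime.ne_top ((Ideal.eq_top_iff_one _).2 ?_)
      have hf : f ∈ I := hI f fun s => by
        have hX : (⟨X s, isHomogeneous_X k s⟩ : V) ∈ (⊤ : Submodule k V) := trivial
        rw [← hPtop] at hX
        have h0 : (X s : A) • Ideal.Quotient.mk I f = 0 := by
          simpa [F, Submodule.mem_colon_singleton] using hX
        exact Ideal.Quotient.eq_zero_iff_mem.1 h0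
      simpa [Submodule.mem_colon_singleton, Ideal.Quotient.eq_zero_iff_mem] using hf
  obtain ⟨ℓ, hℓ⟩ := (Set.ne_univ_iff_exists_notMem _).1 (Subspace.biUnion_ne_univ_of_top_notMem hs)
  simp only [Set.mem_iUnion, not_exists] at hℓ
  refine ⟨ℓ, ℓ.2, fun h0 => hℓ ⊥ (by simp [s]) (by simpa using h0), ?_⟩
  have hreg : IsSMulRegular (A ⧸ I) (ℓ : A) := by
    by_contra hreg
    have h : (ℓ : A) ∈ ({r | IsSMulRegular (A ⧸ I) r}ᶜ : Set A) := hreg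
    rw [← biUnion_associatedPrimes_eq_compl_regular] at h
    obtain ⟨P, hP, hℓP⟩ := Set.mem_iUnion₂.1 h
    exact hℓ (F P) (Finset.mem_insert_of_mem (Finset.mem_image_of_mem _ (by simpa using hP))) hℓP
  intro f hf
  rw [isSMulRegular_iff_right_eq_zero_of_smul] at hreg
  have := hreg (Ideal.Quotient.mk I f) (Ideal.Quotient.eq_zero_iff_mem.2 hf)
  exact Ideal.Quotient.eq_zero_iff_mem.1 this

end Saturation

section LowerBound

open MvPolynomial Module

variable {k : Type*} [Field k]

theorem IsIrrelevantSaturated.eq_top_of_hilbFn_eq_zero {I : Ideal (MvPolynomial (Fin 1) k)}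
    (hI : IsIrrelevantSaturated I) {m : ℕ} (h : hilbFn I m = 0) : I = ⊤ := by
  have hX : (X 0 : MvPolynomial (Fin 1) k) ^ m ∈ I :=
    exists_mem_of_hilbFn_eq_zero h (isHomogeneous_X_pow 0 m)
  clear h
  induction m with
  | zero => exact (Ideal.eq_top_iff_one I).2 (by simpa using hX)
  | succ m ih =>
    refine ih (hI _ fun s => ?_)
    rwa [Subsingleton.elim s 0, ← pow_succ']

theorem mem_span_gradedPart_top {f : MvPolynomial (Fin 1) k} {i : ℕ} (hf : f.IsHomogeneous (i + 1)) :
    f ∈ Ideal.span (gradedPart (⊤ : Ideal (MvPolynomial (Fin 1) k)) i :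
      Set (MvPolynomial (Fin 1) k)) := by
  have h : f ∈ homogeneousSubmodule (Fin 1) k (i + 1) := hf
  rw [← homogeneousSubmodule_one_pow, homogeneousSubmodule_one_eq_span_X, Set.range_unique,
    Submodule.span_pow, Set.singleton_pow, Submodule.mem_span_singleton] at h
  obtain ⟨c, rfl⟩ := h
  rw [smul_eq_C_mul, pow_succ', ← mul_assoc]
  exact Ideal.mul_mem_left _ _
    (Ideal.subset_span (mem_gradedPart.2 ⟨isHomogeneous_X_pow _ i, trivial⟩))

/-- If partial sums of `D` are eventually `B - A`, and `D` vanishes from any point `j ≥ A` on at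
which it vanishes, then these partial sums are at least as large as those of the indicator function
of `[A, B)`, and agree with them from `B` on. -/
theorem partial_sums_of_persistent {D : ℕ → ℕ} {A B M : ℕ} (hAB : A ≤ B)
    (hM : ∀ i, M ≤ i → ∑ j ∈ Finset.range (i + 1), D j = B - A)
    (hD : ∀ j, A ≤ j → D j = 0 → D (j + 1) = 0) :
    (∀ i, min (i + 1 - A) (B - A) ≤ ∑ j ∈ Finset.range (i + 1), D j) ∧
      (∀ j, B ≤ j → D j = 0) ∧ ∀ i, B ≤ i → ∑ j ∈ Finset.range (i + 1), D j = B - A := by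
  have hmono : Monotone fun i => ∑ j ∈ Finset.range i, D j :=
    Finset.sum_mono_set D |>.comp Finset.range_mono
  have hle : ∀ i, ∑ j ∈ Finset.range (i + 1), D j ≤ B - A := fun i =>
    (hmono (Nat.succ_le_succ (le_max_left i M))).trans (hM _ (le_max_right i M)).le
  have hpers : ∀ j, A ≤ j → D j = 0 → ∀ j', j ≤ j' → D j' = 0 := by
    intro j hj h0 j' hj'
    induction j', hj' using Nat.le_induction with
    | base => exact h0
    | succ j' hj' ih => exact hD j' (hj.trans hj') ih
  have hfull : ∀ j i, A ≤ j → j ≤ i + 1 → D j = 0 → ∑ t ∈ Finset.range (i + 1), D t = B - A := by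
    intro j i hj hji h0
    rw [← hM (max i M) (le_max_right _ _)]
    refine Finset.sum_subset (Finset.range_mono (Nat.succ_le_succ (le_max_left _ _))) ?_
    intro t _ ht
    exact hpers j hj h0 t (by simp at ht; omega)
  have hpos : ∀ i, (∀ j, A ≤ j → j ≤ i → D j ≠ 0) →
      i + 1 - A ≤ ∑ j ∈ Finset.range (i + 1), D j := by
    intro i h
    calc i + 1 - A = ∑ j ∈ Finset.Ico A (i + 1), 1 := by simp
      _ ≤ ∑ j ∈ Finset.Ico A (i + 1), D j := Finset.sum_le_sum fun j hj => by
        rw [Finset.mem_Ico] at hj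
        exact Nat.one_le_iff_ne_zero.2 (h j hj.1 (by omega))
      _ ≤ ∑ j ∈ Finset.range (i + 1), D j := Finset.sum_le_sum_of_subset fun j hj => by
        rw [Finset.mem_Ico] at hj
        simpa using hj.2
  have hB : D B = 0 := by
    by_contra hB
    have := hpos B fun j hj hjB h0 => hB (hpers j hj h0 B hjB)
    have := hle B
    omega
  refine ⟨fun i => ?_, hpers B hAB hB, fun i hi => hfull B i hAB (by omega) hB⟩
  by_cases h : ∃ j, A ≤ j ∧ j ≤ i ∧ D j = 0
  · obtain ⟨j, hj, hji, h0⟩ := h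
    rw [hfull j i hj (by omega) h0]
    exact min_le_right _ _
  · push Not at h
    exact (min_le_left _ _).trans (hpos i h)

theorem IsIrrelevantSaturated.lexHilb_le_hilbFn [Infinite k] (n : ℕ) :
    ∀ {I : Ideal (MvPolynomial (Fin (n + 1)) k)}, IsHomogeneousIdeal I → IsIrrelevantSaturated I →
      ∀ {e : ℕ → ℕ}, Antitone e → (∃ M, ∀ i, M ≤ i → hilbFn I i = lexHilb n e i) →
      (∀ i, lexHilb n e i ≤ hilbFn I i) ∧ (∀ i, e 0 ≤ i → hilbFn I i = lexHilb n e i) ∧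
      ∀ i, e 0 ≤ i → ∀ f ∈ gradedPart I (i + 1), f ∈ Ideal.span (gradedPart I i :
        Set (MvPolynomial (Fin (n + 1)) k)) := by
  induction n with
  | zero =>
    rintro I - hsat e - ⟨M, hM⟩
    obtain rfl := hsat.eq_top_of_hilbFn_eq_zero (hM M le_rfl)
    exact ⟨fun i => by simp [lexHilb], fun i _ => hilbFn_top i,
      fun i _ f hf => mem_span_gradedPart_top (mem_gradedPart.1 hf).1⟩
  | succ n ih =>
    rintro I hI hsat e he ⟨M, hM⟩
    obtain ⟨ℓ, hℓ, hℓ0, hreg⟩ := hsat.exists_regular_form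
    obtain ⟨r, rfl⟩ := HyperplaneRestriction.exists_of_form hℓ hℓ0
    have hsum := r.hilbFn_eq_sum hI hreg
    set I' := r.restrict I with hI'def
    have hI' : IsHomogeneousIdeal I' := r.isHomogeneousIdeal_restrict hI
    obtain ⟨J, hIJ, hJ, hJsat, M', hM'⟩ := exists_isIrrelevantSaturated_ge hI'
    set e' : ℕ → ℕ := fun j => e (j + 1) with he'def
    have he' : Antitone e' := fun a b hab => he (Nat.succ_le_succ hab)
    have hlex : ∀ i, lexHilb (n + 1) e i = ∑ t ∈ Finset.range (i + 1), lexHilb n e' t +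
        min (i + 1 - e 1) (e 0 - e 1) := lexHilb_succ n e
    have hJev : ∃ M, ∀ i, M ≤ i → hilbFn J i = lexHilb n e' i := by
      refine ⟨max M' (max (M + 1) (e 0 + 1)), fun i hi => ?_⟩
      rw [hilbFn_congr (hM' i (le_of_max_le_left hi))]
      have hi' := le_of_max_le_right hi
      obtain ⟨m, rfl⟩ := Nat.exists_eq_add_of_le' (le_trans (Nat.le_add_left 1 _)
        (le_of_max_le_left hi'))
      have h1 := hM m (by omega)
      have h2 := hM (m + 1) (by omega)
      rw [hsum, hlex] at h1 h2
      rw [Finset.sum_range_succ, Finset.sum_range_succ (fun t => lexHilb n e' t)] at h2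
      have h3 := he (Nat.zero_le 1)
      omega
    obtain ⟨hJle, hJeq, hJgen⟩ := ih hJ hJsat he' hJev
    have hle : ∀ i, lexHilb n e' i ≤ hilbFn I' i := fun i =>
      (hJle i).trans (hilbFn_le_of_gradedPart_le (gradedPart_mono hIJ i))
    let D : ℕ → ℕ := fun i => hilbFn I' i - lexHilb n e' i
    have hDsum : ∀ i, hilbFn I i + min (i + 1 - e 1) (e 0 - e 1) =
        lexHilb (n + 1) e i + ∑ j ∈ Finset.range (i + 1), D j := by
      intro i
      have : ∑ j ∈ Finset.range (i + 1), hilbFn I' j =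
          ∑ j ∈ Finset.range (i + 1), lexHilb n e' j + ∑ j ∈ Finset.range (i + 1), D j := by
        rw [← Finset.sum_add_distrib]
        exact Finset.sum_congr rfl fun j _ => (Nat.add_sub_cancel' (hle j)).symm
      rw [hsum, hlex, this]
      ring
    have hgr : ∀ j, e 1 ≤ j → D j = 0 → gradedPart I' j = gradedPart J j := by
      intro j hj hD
      refine gradedPart_eq_of_hilbFn_eq (gradedPart_mono hIJ j) ?_
      rw [hJeq j hj]
      exact le_antisymm (Nat.sub_eq_zero_iff_le.1 hD) (hle j)
    obtain ⟨h1, h2, h3⟩ := partial_sums_of_persistent (D := D) (A := e 1) (B := e 0)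
      (M := max M (e 0)) (he zero_le_one) (fun i hi => by
        have h1 := hDsum i
        have h2 := hM i (le_of_max_le_left hi)
        have h3 := le_of_max_le_right hi
        have h4 := he (Nat.zero_le 1)
        omega) (fun j hj hD => by
        have h : gradedPart I' (j + 1) = gradedPart J (j + 1) := by
          refine le_antisymm (gradedPart_mono hIJ _) fun f hf => ?_
          refine mem_gradedPart.2 ⟨(mem_gradedPart.1 hf).1, ?_⟩
          refine Ideal.span_le.2 ?_ (hJgen j hj f hf)
          rw [← hgr j hj hD]
          exact fun g hg => (mem_gradedPart.1 hg).2
        simp only [D]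
        rw [hilbFn_congr h, hJeq (j + 1) (Nat.le_succ_of_le hj), Nat.sub_self])
    refine ⟨fun i => ?_, fun i hi => ?_, fun i hi f hf => ?_⟩
    · have := hDsum i
      have := h1 i
      omega
    · have := hDsum i
      have := h3 i hi
      have := he (Nat.zero_le 1)
      omega
    · have hi1 : e 1 ≤ i := (he zero_le_one).trans hi
      rw [mem_gradedPart] at hf
      have hspan : IsHomogeneousIdeal (Ideal.span (gradedPart I i :
          Set (MvPolynomial (Fin (n + 2)) k))) :=
        isHomogeneousIdeal_span fun g hg => ⟨i, (mem_gradedPart.1 hg).1⟩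
      have hspan_le : Ideal.span (gradedPart I i : Set (MvPolynomial (Fin (n + 2)) k)) ≤ I :=
        Ideal.span_le.2 fun g hg => (mem_gradedPart.1 hg).2
      have hmem : r.toHom f ∈ r.restrict (Ideal.span (gradedPart I i :
          Set (MvPolynomial (Fin (n + 2)) k))) := by
        have h := hJgen i hi1 (r.toHom f) (mem_gradedPart.2
          ⟨r.isHomogeneous_toHom hf.1, hIJ (Ideal.mem_map_of_mem _ hf.2)⟩)
        rw [← hgr i hi1 (h2 i hi), hI'def, ← r.map_gradedPart hI] at h
        rw [HyperplaneRestriction.restrict, Ideal.map_span]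
        exact h
      obtain ⟨g, hg, hgi, hgf⟩ :=
        r.exists_of_mem_restrict hspan hmem (r.isHomogeneous_toHom hf.1)
      obtain ⟨q, hq, hqi, hfq⟩ := r.exists_mul_form hI hreg (I.sub_mem hf.2 (hspan_le hg))
        (hf.1.sub hgi) (by rw [map_sub, hgf, sub_self])
      rw [← sub_add_cancel f g, hfq]
      exact Ideal.add_mem _ (Ideal.mul_mem_left _ _ (Ideal.subset_span
        (mem_gradedPart.2 ⟨hqi, hq⟩))) hg

theorem lexHilb_le_hilbFn_of_infinite [Infinite k] {n : ℕ}
    {I : Ideal (MvPolynomial (Fin (n + 1)) k)} (hI : IsHomogeneousIdeal I) {e : ℕ → ℕ}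
    (he : Antitone e) (hp : ∃ M, ∀ i, M ≤ i → hilbFn I i = lexHilb n e i) (i : ℕ) :
    lexHilb n e i ≤ hilbFn I i := by
  obtain ⟨M, hM⟩ := hp
  obtain ⟨J, hIJ, hJ, hJsat, M', hM'⟩ := exists_isIrrelevantSaturated_ge hI
  refine ((hJsat.lexHilb_le_hilbFn n hJ he ⟨max M M', fun i hi => ?_⟩).1 i).trans
    (hilbFn_le_of_gradedPart_le (gradedPart_mono hIJ i))
  rw [hilbFn_congr (hM' i (le_of_max_le_right hi)), hM i (le_of_max_le_left hi)]

end LowerBound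

section BaseChange

open MvPolynomial Module

variable {k : Type*} [Field k] {N : ℕ} (K : Type*) [Field K] [Algebra k K]

theorem finrank_homogeneousSubmodule (i : ℕ) :
    finrank k (homogeneousSubmodule (Fin N) k i) = Nat.card {d : Fin N →₀ ℕ | d.degree = i} := by
  rw [homogeneousSubmodule_eq_finsupp_supported]
  exact finrank_eq_nat_card_basis (basisRestrictSupport k {d : Fin N →₀ ℕ | d.degree = i})

/-- The `K`-span of the image of a set of polynomials over `k`. -/
noncomputable def spanMap (W : Set (MvPolynomial (Fin N) k)) :
    Submodule K (MvPolynomial (Fin N) K) :=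
  Submodule.span K (MvPolynomial.map (algebraMap k K) '' W)

theorem map_mem_spanMap {W : Set (MvPolynomial (Fin N) k)} {f : MvPolynomial (Fin N) k}
    (hf : f ∈ W) : MvPolynomial.map (algebraMap k K) f ∈ spanMap K W :=
  Submodule.subset_span ⟨f, hf, rfl⟩

theorem spanMap_le_span_range_basis {ι : Type*} [Fintype ι]
    {W : Submodule k (MvPolynomial (Fin N) k)} (b : Basis ι k W) :
    spanMap K (W : Set (MvPolynomial (Fin N) k)) ≤
      Submodule.span K (Set.range fun j => MvPolynomial.map (algebraMap k K) (b j).1) := by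
  refine Submodule.span_le.2 ?_
  rintro _ ⟨w, hw, rfl⟩
  have h := congrArg Subtype.val (b.sum_repr ⟨w, hw⟩)
  simp only [Submodule.coe_sum, Submodule.coe_smul] at h
  rw [← h, map_sum]
  refine Submodule.sum_mem _ fun j _ => ?_
  rw [smul_eq_C_mul, map_mul, map_C, ← smul_eq_C_mul]
  exact Submodule.smul_mem _ _ (Submodule.subset_span ⟨j, rfl⟩)

instance finite_spanMap (W : Submodule k (MvPolynomial (Fin N) k)) [Module.Finite k W] :
    Module.Finite K (spanMap K (W : Set (MvPolynomial (Fin N) k))) := by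
  have := Module.Finite.span_of_finite K (Set.finite_range
    fun j => MvPolynomial.map (algebraMap k K) (Module.finBasis k W j).1)
  exact Submodule.finiteDimensional_of_le (spanMap_le_span_range_basis K (Module.finBasis k W))

theorem finrank_spanMap_le (W : Submodule k (MvPolynomial (Fin N) k)) [Module.Finite k W] :
    finrank K (spanMap K (W : Set (MvPolynomial (Fin N) k))) ≤ finrank k W := by
  have := Module.Finite.span_of_finite K (Set.finite_range
    fun j => MvPolynomial.map (algebraMap k K) (Module.finBasis k W j).1)
  exact (Submodule.finrank_mono (spanMap_le_span_range_basis K (Module.finBasis k W))).trans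
    ((finrank_range_le_card _).trans (by simp))

theorem mul_mem_spanMap {I : Ideal (MvPolynomial (Fin N) k)} (a : MvPolynomial (Fin N) K)
    {x : MvPolynomial (Fin N) K} (hx : x ∈ spanMap K (I : Set (MvPolynomial (Fin N) k))) :
    a * x ∈ spanMap K (I : Set (MvPolynomial (Fin N) k)) := by
  induction hx using Submodule.span_induction with
  | mem x hx =>
    obtain ⟨g, hg, rfl⟩ := hx
    induction a using MvPolynomial.induction_on' with
    | monomial d c =>
      have h : monomial d c * MvPolynomial.map (algebraMap k K) g =
          c • MvPolynomial.map (algebraMap k K) (monomial d 1 * g) := by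
        rw [map_mul, map_monomial, map_one, ← smul_mul_assoc, smul_monomial, smul_eq_mul, mul_one]
      rw [h]
      exact Submodule.smul_mem _ _ (map_mem_spanMap K (I.mul_mem_left _ hg))
    | add p q hp hq =>
      rw [add_mul]
      exact Submodule.add_mem _ hp hq
  | zero => simp
  | add x y _ _ hx hy =>
    rw [mul_add]
    exact Submodule.add_mem _ hx hy
  | smul c x _ hx =>
    rw [mul_smul_comm]
    exact Submodule.smul_mem _ _ hx

theorem mem_spanMap_of_mem_map {I : Ideal (MvPolynomial (Fin N) k)}
    {f : MvPolynomial (Fin N) K} (hf : f ∈ I.map (MvPolynomial.map (algebraMap k K))) :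
    f ∈ spanMap K (I : Set (MvPolynomial (Fin N) k)) := by
  induction hf using Submodule.span_induction with
  | mem x hx => exact Submodule.subset_span hx
  | zero => exact Submodule.zero_mem _
  | add x y _ _ hx hy => exact Submodule.add_mem _ hx hy
  | smul a x _ hx => exact mul_mem_spanMap K a hx

theorem gradedPart_map_le {I : Ideal (MvPolynomial (Fin N) k)} (hI : IsHomogeneousIdeal I)
    (i : ℕ) : gradedPart (I.map (MvPolynomial.map (algebraMap k K))) i ≤
      spanMap K (gradedPart I i : Set (MvPolynomial (Fin N) k)) := by
  intro f hf
  rw [mem_gradedPart] at hf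
  rw [← homogeneousComponent_eq_self hf.1]
  have hle : spanMap K (I : Set (MvPolynomial (Fin N) k)) ≤
      (spanMap K (gradedPart I i : Set (MvPolynomial (Fin N) k))).comap
        (homogeneousComponent i) := by
    refine Submodule.span_le.2 ?_
    rintro _ ⟨g, hg, rfl⟩
    refine Submodule.subset_span ⟨homogeneousComponent i g,
      mem_gradedPart.2 ⟨homogeneousComponent_isHomogeneous i g, hI g hg i⟩, ?_⟩
    exact (homogeneousComponent_map_of_isHomogeneous (MvPolynomial.map (algebraMap k K))
      (fun _ _ h => h.map _) i g).symm
  exact hle (mem_spanMap_of_mem_map K hf.2)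

theorem hilbFn_le_of_le_sup {L : Ideal (MvPolynomial (Fin N) k)} {i : ℕ}
    {W : Submodule k (MvPolynomial (Fin N) k)} [Module.Finite k W]
    (h : homogeneousSubmodule (Fin N) k i ≤ gradedPart L i ⊔ W) : hilbFn L i ≤ finrank k W := by
  have h1 := hilbFn_add_finrank_gradedPart L i
  have h2 := Submodule.finrank_mono h
  have h3 := Submodule.finrank_add_le_finrank_add_finrank (gradedPart L i) W
  omega

theorem homogeneousSubmodule_le_of_monomial {i : ℕ} {W : Submodule k (MvPolynomial (Fin N) k)}
    (h : ∀ u : Fin N →₀ ℕ, u.degree = i → monomial u 1 ∈ W) :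
    homogeneousSubmodule (Fin N) k i ≤ W := by
  intro f hf
  rw [← f.support_sum_monomial_coeff]
  refine Submodule.sum_mem _ fun u hu => ?_
  have hc : monomial u (f.coeff u) = f.coeff u • monomial u (1 : k) := by
    rw [smul_monomial, smul_eq_mul, mul_one]
  rw [hc]
  refine Submodule.smul_mem _ _ (h u ?_)
  exact (Finsupp.degree_eq_weight_one (R := ℕ) ▸ hf (mem_support_iff.1 hu) :)

/-- The Hilbert function of a homogeneous ideal is invariant under extension of the base field. -/
theorem hilbFn_map_algebraMap {I : Ideal (MvPolynomial (Fin N) k)} (hI : IsHomogeneousIdeal I)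
    (i : ℕ) : hilbFn (I.map (MvPolynomial.map (algebraMap k K))) i = hilbFn I i := by
  have h1 := hilbFn_add_finrank_gradedPart I i
  have h2 := hilbFn_add_finrank_gradedPart (I.map (MvPolynomial.map (algebraMap k K))) i
  rw [finrank_homogeneousSubmodule] at h1 h2
  have h3 := (Submodule.finrank_mono (gradedPart_map_le K hI i)).trans (finrank_spanMap_le K _)
  refine le_antisymm ?_ (by omega)
  obtain ⟨W, hW⟩ := Submodule.exists_isCompl
    ((gradedPart I i).comap (homogeneousSubmodule (Fin N) k i).subtype)
  set W' := W.map (homogeneousSubmodule (Fin N) k i).subtype with hW'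
  have h4 : finrank k W' ≤ hilbFn I i := by
    have h5 := Submodule.finrank_add_eq_of_isCompl hW
    have h6 : finrank k ((gradedPart I i).comap (homogeneousSubmodule (Fin N) k i).subtype) =
        finrank k (gradedPart I i) := by
      rw [(Submodule.equivMapOfInjective _ (Submodule.injective_subtype _) _).finrank_eq,
        Submodule.map_comap_subtype, inf_eq_right.2 (gradedPart_le I i)]
    have h7 := Submodule.finrank_map_le (homogeneousSubmodule (Fin N) k i).subtype W
    rw [finrank_homogeneousSubmodule] at h5
    rw [← hW'] at h7
    omega
  refine (hilbFn_le_of_le_sup (W := spanMap K (W' : Set (MvPolynomial (Fin N) k)))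
    (homogeneousSubmodule_le_of_monomial fun u hu => ?_)).trans
    ((finrank_spanMap_le K W').trans h4)
  have hu' : (monomial u (1 : k)).IsHomogeneous i := isHomogeneous_monomial _ hu
  have hmem : (⟨monomial u 1, hu'⟩ : homogeneousSubmodule (Fin N) k i) ∈
      (gradedPart I i).comap (homogeneousSubmodule (Fin N) k i).subtype ⊔ W := by
    rw [hW.sup_eq_top]
    trivial
  obtain ⟨y, hy, z, hz, hyz⟩ := Submodule.mem_sup.1 hmem
  have hyz' : y.1 + z.1 = monomial u 1 := congrArg Subtype.val hyz
  rw [← map_one (algebraMap k K), ← map_monomial, ← hyz', map_add]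
  refine Submodule.add_mem_sup (mem_gradedPart.2 ⟨?_, Ideal.mem_map_of_mem _ ?_⟩)
    (map_mem_spanMap K ⟨z, hz, rfl⟩)
  · exact (mem_gradedPart.1 hy).1.map _
  · exact (mem_gradedPart.1 hy).2

end BaseChange

section LexicographicIdeal

open MvPolynomial Module Finset

/-- The exponent vectors in `n + 1` variables that start with `a (n - 1), …, a (j + 1), c` and
continue with the entries of `v`. -/
noncomputable def lexStandardExp (n : ℕ) (a : ℕ → ℕ) (j c : ℕ) (v : Fin (j + 1) →₀ ℕ) :
    Fin (n + 1) →₀ ℕ :=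
  Finsupp.equivFunOnFinite.symm fun t =>
    if (t : ℕ) < n - 1 - j then a (n - 1 - t)
    else if h : n - 1 - j < (t : ℕ) then v ⟨t - (n - 1 - j) - 1, by omega⟩
    else c

open Classical in
/-- A finite set containing the exponents of degree `i` of the monomials outside of the
lexicographic ideal. -/
noncomputable def lexStandardExps (n : ℕ) (e : ℕ → ℕ) (i : ℕ) : Finset (Fin (n + 1) →₀ ℕ) :=
  (range n).biUnion fun j => ((Ico (e (j + 1)) (e j)).filter (· ≤ i)).biUnion fun c =>
    (finsuppAntidiag (univ : Finset (Fin (j + 1))) (i - c)).image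
      (lexStandardExp n (fun j => e j - e (j + 1)) j (c - e (j + 1)))

theorem card_lexStandardExps_le (n : ℕ) (e : ℕ → ℕ) (i : ℕ) :
    #(lexStandardExps n e i) ≤ lexHilb n e i := by
  refine card_biUnion_le.trans (sum_le_sum fun j _ => card_biUnion_le.trans ?_)
  rw [sum_filter]
  refine sum_le_sum fun c _ => ?_
  split_ifs
  · refine card_image_le.trans ?_
    rw [card_finsuppAntidiag_nat_eq_choose, card_fin,
      show j + 1 + (i - c) - 1 = i - c + j by omega, ← Nat.choose_symm_add]
  · exact le_rfl

theorem sum_range_sub_telescope {n : ℕ} {e : ℕ → ℕ} (he : Antitone e) (hen : e n = 0) {m : ℕ}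
    (hm : m ≤ n) : ∑ t ∈ range m, (e (n - 1 - t) - e (n - 1 - t + 1)) = e (n - m) := by
  induction m with
  | zero => simp [hen]
  | succ m ih =>
    rw [sum_range_succ, ih (by omega), show n - 1 - m + 1 = n - m by omega,
      show n - (m + 1) = n - 1 - m by omega]
    have := he (show n - 1 - m ≤ n - m by omega)
    omega

theorem exists_prefix_of_not_lexExp_le {n : ℕ} (hn : 0 < n) {a : ℕ → ℕ} {u : Fin (n + 1) →₀ ℕ}
    (h : ∀ m < n, ¬ lexExp n a m ≤ u) :
    ∃ m, ∃ hm : m < n, (∀ t : Fin (n + 1), (t : ℕ) < m → u t = a (n - 1 - t)) ∧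
      u ⟨m, by omega⟩ < a (n - 1 - m) := by
  by_contra! hc
  have hpre : ∀ m < n, ∀ t : Fin (n + 1), (t : ℕ) < m → u t = a (n - 1 - t) := by
    intro m
    induction m with
    | zero => exact fun _ t ht => absurd ht (Nat.not_lt_zero _)
    | succ m ih =>
      intro hm t ht
      have hu := ih (by omega)
      rcases Nat.lt_succ_iff_lt_or_eq.1 ht with h1 | h1
      · exact hu t h1
      · have h2 := hc m (by omega) hu
        have h3 : ¬ a (n - 1 - m) + 1 ≤ u ⟨m, by omega⟩ := fun h4 => h m (by omega) fun s => by
          simp only [lexExp, Finsupp.equivFunOnFinite_symm_apply_apply]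
          split_ifs with h5 h6 h7
          · exact (hu s h5).ge
          · omega
          · rw [show s = ⟨m, by omega⟩ from Fin.ext h6]
            exact h4
          · exact Nat.zero_le _
        rw [show t = ⟨m, by omega⟩ from Fin.ext h1]
        simp only
        omega
  refine h (n - 1) (by omega) fun s => ?_
  simp only [lexExp, Finsupp.equivFunOnFinite_symm_apply_apply]
  split_ifs with h5 h6
  · exact (hpre (n - 1) (by omega) s h5).ge
  · have := hc (n - 1) (by omega) (hpre (n - 1) (by omega))
    rw [show s = ⟨n - 1, by omega⟩ from Fin.ext h6]
    simpa using this
  · exact Nat.zero_le _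

theorem mem_lexStandardExps {n : ℕ} {e : ℕ → ℕ} (he : Antitone e) (hen : e n = 0) {i : ℕ}
    {u : Fin (n + 1) →₀ ℕ} (hu : u.degree = i) {m : ℕ} (hm : m < n)
    (hpre : ∀ t : Fin (n + 1), (t : ℕ) < m → u t = e (n - 1 - t) - e (n - 1 - t + 1))
    (hlt : u ⟨m, by omega⟩ < e (n - 1 - m) - e (n - 1 - m + 1)) :
    u ∈ lexStandardExps n e i := by
  obtain ⟨j, rfl⟩ : ∃ j, n = m + 1 + j := ⟨n - (m + 1), by omega⟩
  simp only [show m + 1 + j - 1 - m = j by omega] at hlt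
  have hsum : e (j + 1) + u ⟨m, by omega⟩ + ∑ s : Fin (j + 1), u (Fin.natAdd (m + 1) s) = i := by
    rw [← hu, Finsupp.degree_eq_sum]
    have h1 := Fin.sum_univ_add (a := m + 1) (b := j + 1) (fun t => u t)
    have h2 : ∑ t : Fin m, u (Fin.castAdd (j + 1) t.castSucc) = e (j + 1) := by
      have h3 := sum_range_sub_telescope he hen (m := m) (by omega)
      rw [show m + 1 + j - m = j + 1 by omega, ← Fin.sum_univ_eq_sum_range
        (fun t => e (m + 1 + j - 1 - t) - e (m + 1 + j - 1 - t + 1))] at h3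
      rw [← h3]
      exact sum_congr rfl fun t _ => hpre _ t.2
    rw [Fin.sum_univ_castSucc, h2] at h1
    exact h1.symm
  have hlt' := he (Nat.le_succ j)
  rw [lexStandardExps, mem_biUnion]
  refine ⟨j, by simp, mem_biUnion.2 ⟨e (j + 1) + u ⟨m, by omega⟩, ?_, ?_⟩⟩
  · simp only [mem_filter, mem_Ico]
    omega
  · refine mem_image.2 ⟨Finsupp.equivFunOnFinite.symm fun s => u (Fin.natAdd (m + 1) s), ?_, ?_⟩
    · rw [mem_finsuppAntidiag]
      refine ⟨?_, subset_univ _⟩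
      simp only [Finsupp.equivFunOnFinite_symm_apply_apply]
      omega
    · ext t
      simp only [lexStandardExp, Finsupp.equivFunOnFinite_symm_apply_apply]
      split_ifs with h1 h2
      · exact (hpre t (by omega)).symm
      · congr 1
        ext
        simp only [Fin.val_natAdd]
        omega
      · rw [Nat.add_sub_cancel_left]
        congr 1
        ext
        simp only
        omega

theorem hilbFn_lexIdealGen_le (k : Type*) [Field k] {n : ℕ} (hn : 0 < n) {e : ℕ → ℕ}
    (he : Antitone e) (hen : e n = 0) (i : ℕ) :
    hilbFn (lexIdealGen k n fun j => e j - e (j + 1)) i ≤ lexHilb n e i := by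
  classical
  set T := (lexStandardExps n e i).image fun u => monomial u (1 : k)
  have hT : finrank k (Submodule.span k (T : Set (MvPolynomial (Fin (n + 1)) k))) ≤
      lexHilb n e i :=
    (finrank_span_finset_le_card T).trans (card_image_le.trans (card_lexStandardExps_le n e i))
  refine (hilbFn_le_of_le_sup (homogeneousSubmodule_le_of_monomial fun u hu => ?_)).trans hT
  by_cases h : ∃ m < n, lexExp n (fun j => e j - e (j + 1)) m ≤ u
  · obtain ⟨m, hm, hmu⟩ := h
    refine Submodule.mem_sup_left (mem_gradedPart.2 ⟨isHomogeneous_monomial _ hu, ?_⟩)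
    have h1 : monomial u (1 : k) = monomial (u - lexExp n (fun j => e j - e (j + 1)) m) 1 *
        monomial (lexExp n (fun j => e j - e (j + 1)) m) 1 := by
      rw [monomial_mul, tsub_add_cancel_of_le hmu, mul_one]
    rw [h1]
    exact Ideal.mul_mem_left _ _ (Ideal.subset_span ⟨m, hm, rfl⟩)
  · push Not at h
    obtain ⟨m, hm, hpre, hlt⟩ := exists_prefix_of_not_lexExp_le hn h
    exact Submodule.mem_sup_right (Submodule.subset_span
      (mem_image_of_mem _ (mem_lexStandardExps he hen hu hm hpre hlt)))

end LexicographicIdeal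

/-- For a homogeneous ideal `I ⊆ k[x_0,…,x_n]` with Hilbert polynomial `p` of degree
`d < n`: (i) the Hilbert function of `I` dominates that of the lexicographic ideal
`L^p_n`; and (ii) the Hilbert function of the extension ideal `I·k[x_0,…,x_{n+1}]` is
given by partial sums of the Hilbert function of `I`. -/
theorem statement_17 (k : Type*) [Field k] (n d : ℕ) (hdn : d < n)
    (I : Ideal (MvPolynomial (Fin (n + 1)) k)) (hhom : IsHomogeneousIdeal I)
    (e : Fin (d + 1) → ℤ) (he : Antitone e) (hepos : ∀ i, 0 < e i)
    (hp : ∃ N : ℕ, ∀ i : ℕ, N ≤ i → (hilbFn I i : ℚ) = (mhSum d e).eval (i : ℚ)) :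
    (∀ i : ℕ, hilbFn (lexIdealGen k n (aSeq d e)) i ≤ hilbFn I i) ∧
    (∀ i : ℕ,
      hilbFn (Ideal.map (MvPolynomial.rename (Fin.castSucc : Fin (n + 1) → Fin (n + 2))) I) i
        = ∑ j ∈ Finset.range (i + 1), hilbFn I j) := by
  have he' := antitone_eExt he
  have hen : (fun j => (eExt d e j).toNat) n = 0 := by simp [eExt, not_le.2 hdn]
  have ha : aSeq d e = fun j => (eExt d e j).toNat - (eExt d e (j + 1)).toNat := by
    ext j
    have h : 0 ≤ eExt d e (j + 1) := by
      rw [eExt]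
      split_ifs
      exacts [(hepos _).le, le_rfl]
    rw [aSeq]
    omega
  have hp' : ∃ M, ∀ i, M ≤ i → hilbFn I i = lexHilb n (fun j => (eExt d e j).toNat) i := by
    obtain ⟨M, hM⟩ := hp
    refine ⟨max M (eExt d e 0).toNat, fun i hi => ?_⟩
    have h := hM i (le_of_max_le_left hi)
    rw [eval_mhSum hdn he hepos (le_of_max_le_right hi)] at h
    exact_mod_cast h
  refine ⟨fun i => ?_, hilbFn_map_rename_castSucc hhom⟩
  rw [ha]
  refine (hilbFn_lexIdealGen_le k (by omega) he' hen i).trans ?_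
  rw [← hilbFn_map_algebraMap (AlgebraicClosure k) hhom]
  refine lexHilb_le_hilbFn_of_infinite (hhom.map _ fun _ _ h => h.map _) he' ?_ i
  simpa only [hilbFn_map_algebraMap (AlgebraicClosure k) hhom] using hp'
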